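/- For every real ν > 0 and every integer k ≥ 2, the set W(ν,k) of all irrational real numbers α whose continued fraction data satisfies, for infinitely many n, both a_{n+1} ≥ q_n^ν and gcd(q_n, k) = 1, is a dense Gδ subset of ℝ (a countable intersection of open subsets of ℝ which is dense in ℝ). -/

import Mathlib

/-- The complete quotients of the continued fraction expansion of `α`
(`cfQuot α 0 = α`, and `cfQuot α (n+1)` is the inverse of the fractional part
of `cfQuot α n`). -/
noncomputable def cfQuot (α : ℝ) : ℕ → ℝ
  | 0 => α
  | n + 1 => (cfQuot α n - ⌊cfQuot α n⌋)⁻¹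

/-- The partial quotients `aₙ` of the continued fraction expansion
`α = [a₀; a₁, a₂, …]` (as natural numbers; for irrational `α` and `n ≥ 1`
one has `cfa α n ≥ 1`). -/
noncomputable def cfa (α : ℝ) (n : ℕ) : ℕ := (⌊cfQuot α n⌋).toNat

/-- The denominators `qₙ` of the convergents `pₙ/qₙ` of `α`:
`q₀ = 1`, `q₁ = a₁` and `q_{n+2} = a_{n+2} q_{n+1} + q_n`. -/
noncomputable def cfq (α : ℝ) : ℕ → ℕ
  | 0 => 1
  | 1 => cfa α 1
  | n + 2 => cfa α (n + 2) * cfq α (n + 1) + cfq α n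

/-- The numerators `pₙ` of the convergents `pₙ/qₙ` of `α`:
`p₀ = a₀`, `p₁ = a₁ a₀ + 1` and `p_{n+2} = a_{n+2} p_{n+1} + pₙ`. -/
noncomputable def cfp (α : ℝ) : ℕ → ℤ
  | 0 => ⌊α⌋
  | 1 => (cfa α 1 : ℤ) * ⌊α⌋ + 1
  | n + 2 => (cfa α (n + 2) : ℤ) * cfp α (n + 1) + cfp α n

/-- `ρₙ = qₙ α − pₙ`. -/
noncomputable def cfrho (α : ℝ) (n : ℕ) : ℝ := (cfq α n : ℝ) * α - (cfp α n : ℝ)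

/-- `λ⁽ⁿ⁾ = |ρₙ| = ‖qₙ α‖`, the distance from `qₙ α` to the nearest integer. -/
noncomputable def cflam (α : ℝ) (n : ℕ) : ℝ := |cfrho α n|

theorem irrational_cfQuot {α : ℝ} (h : Irrational α) (n : ℕ) : Irrational (cfQuot α n) := by
  induction n with
  | zero => exact h
  | succ n ih => exact irrational_inv_iff.2 (irrational_sub_intCast_iff.2 ih)

theorem one_lt_cfQuot_succ {α : ℝ} (h : Irrational α) (n : ℕ) : 1 < cfQuot α (n + 1) := by
  have hne := (irrational_cfQuot h n).ne_int ⌊cfQuot α n⌋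
  have hpos : 0 < cfQuot α n - ⌊cfQuot α n⌋ :=
    sub_pos.2 (lt_of_le_of_ne (Int.floor_le _) hne.symm)
  exact (one_lt_inv₀ hpos).2 (by linarith [Int.lt_floor_add_one (cfQuot α n)])

theorem one_le_floor_cfQuot_succ {α : ℝ} (h : Irrational α) (n : ℕ) :
    1 ≤ ⌊cfQuot α (n + 1)⌋ :=
  Int.le_floor.2 (by exact_mod_cast (one_lt_cfQuot_succ h n).le)

theorem one_le_cfa_succ {α : ℝ} (h : Irrational α) (n : ℕ) : 1 ≤ cfa α (n + 1) := by
  have := one_le_floor_cfQuot_succ h n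
  unfold cfa
  omega

theorem cfq_pos {α : ℝ} (h : Irrational α) : ∀ n, 0 < cfq α n
  | 0 => Nat.one_pos
  | 1 => one_le_cfa_succ h 0
  | n + 2 => Nat.add_pos_right _ (cfq_pos h n)

theorem coprime_cfq_succ (α : ℝ) (n : ℕ) : Nat.Coprime (cfq α n) (cfq α (n + 1)) := by
  induction n with
  | zero => exact Nat.coprime_one_left _
  | succ n ih =>
    change Nat.Coprime _ (cfa α (n + 2) * cfq α (n + 1) + cfq α n)
    simpa using ih.symm

theorem cfq_congr {α β : ℝ} : ∀ n, (∀ i ≤ n, cfa α i = cfa β i) → cfq α n = cfq β n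
  | 0, _ => rfl
  | 1, h => h 1 le_rfl
  | n + 2, h => by
    simp only [cfq]
    rw [h _ le_rfl, cfq_congr (n + 1) fun i hi => h i (by omega),
      cfq_congr n fun i hi => h i (by omega)]

theorem eventually_floor_eq_of_irrational {x : ℝ} (hx : Irrational x) :
    ∀ᶠ y in nhds x, ⌊y⌋ = ⌊x⌋ := by
  have hlt : (⌊x⌋ : ℝ) < x := lt_of_le_of_ne (Int.floor_le _) (hx.ne_int _).symm
  filter_upwards [Ioo_mem_nhds hlt (Int.lt_floor_add_one x)] with y hy
  exact Int.floor_eq_iff.2 ⟨hy.1.le, hy.2⟩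

theorem continuousAt_cfQuot {α : ℝ} (h : Irrational α) (n : ℕ) :
    ContinuousAt (fun β => cfQuot β n) α := by
  induction n with
  | zero => exact continuousAt_id
  | succ n ih =>
    have hfl : ContinuousAt (fun β => (⌊cfQuot β n⌋ : ℝ)) α := by
      refine (continuousAt_const (y := (⌊cfQuot α n⌋ : ℝ))).congr ?_
      filter_upwards [ih.eventually (eventually_floor_eq_of_irrational (irrational_cfQuot h n))]
        with β hβ
      rw [hβ]
    exact (ih.sub hfl).inv₀ (sub_ne_zero.2 ((irrational_cfQuot h n).ne_int _))

theorem eventually_cfa_eq {α : ℝ} (h : Irrational α) (n : ℕ) :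
    ∀ᶠ β in nhds α, ∀ i ≤ n, cfa β i = cfa α i := by
  refine (Set.finite_Iic n).eventually_all.2 fun i _ => ?_
  filter_upwards [(continuousAt_cfQuot h i).eventually
    (eventually_floor_eq_of_irrational (irrational_cfQuot h i))] with β hβ
  rw [cfa, cfa, hβ]

/-- The first `n + 1` digits of `α` may be followed by any irrational complete quotient `y > 1`. -/
theorem exists_cfQuot_succ_eq {α : ℝ} (h : Irrational α) (n : ℕ) {y : ℝ} (hy : Irrational y)
    (hy1 : 1 < y) : ∃ β, Irrational β ∧ (∀ i ≤ n, ⌊cfQuot β i⌋ = ⌊cfQuot α i⌋) ∧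
      cfQuot β (n + 1) = y := by
  have floor_eq (a : ℤ) {y : ℝ} (hy1 : 1 < y) : ⌊(a : ℝ) + y⁻¹⌋ = a := by
    rw [Int.floor_intCast_add, Int.floor_eq_zero_iff.2 ⟨by positivity, inv_lt_one_of_one_lt₀ hy1⟩,
      add_zero]
  induction n generalizing y with
  | zero =>
    refine ⟨⌊α⌋ + y⁻¹, irrational_intCast_add_iff.2 (irrational_inv_iff.2 hy), ?_, ?_⟩
    · intro i hi
      obtain rfl := Nat.le_zero.1 hi
      exact floor_eq _ hy1
    · simp only [cfQuot]
      rw [floor_eq _ hy1]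
      simp
  | succ n ih =>
    have h1 : (1 : ℝ) ≤ ⌊cfQuot α (n + 1)⌋ := by exact_mod_cast one_le_floor_cfQuot_succ h n
    have h2 : 0 < y⁻¹ := by positivity
    obtain ⟨β, hβ, hfl, hq⟩ := ih (y := ⌊cfQuot α (n + 1)⌋ + y⁻¹)
      (irrational_intCast_add_iff.2 (irrational_inv_iff.2 hy)) (by linarith)
    refine ⟨β, hβ, fun i hi => ?_, ?_⟩
    · rcases hi.lt_or_eq with hi | rfl
      · exact hfl i (by omega)
      · rw [hq, floor_eq _ hy1]
    · rw [cfQuot, hq, floor_eq _ hy1]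
      simp

theorem cfQuot_eq_floor_add_inv (α : ℝ) (n : ℕ) :
    cfQuot α n = ⌊cfQuot α n⌋ + (cfQuot α (n + 1))⁻¹ := by
  simp [cfQuot]

theorem abs_sub_cfQuot_le {α β : ℝ} (hα : Irrational α) (hβ : Irrational β) {n : ℕ}
    (h0 : ⌊cfQuot α n⌋ = ⌊cfQuot β n⌋) (h1 : ⌊cfQuot α (n + 1)⌋ = ⌊cfQuot β (n + 1)⌋) :
    |cfQuot α n - cfQuot β n| ≤ |cfQuot α (n + 2) - cfQuot β (n + 2)| / 4 := by
  have key {γ : ℝ} (hγ : Irrational γ) : 2 ≤ cfQuot γ (n + 1) * cfQuot γ (n + 2) := by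
    have e := cfQuot_eq_floor_add_inv γ (n + 1)
    have hx := one_lt_cfQuot_succ hγ (n + 1)
    have hf : (1 : ℝ) ≤ ⌊cfQuot γ (n + 1)⌋ := by exact_mod_cast one_le_floor_cfQuot_succ hγ n
    rw [e, add_mul, inv_mul_cancel₀ (by linarith)]
    nlinarith
  have ea := cfQuot_eq_floor_add_inv α n
  have eb := cfQuot_eq_floor_add_inv β n
  have ea' := cfQuot_eq_floor_add_inv α (n + 1)
  have eb' := cfQuot_eq_floor_add_inv β (n + 1)
  have ka := key hα
  have kb := key hβ
  have a1 := one_lt_cfQuot_succ hα n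
  have b1 := one_lt_cfQuot_succ hβ n
  have a2 := one_lt_cfQuot_succ hα (n + 1)
  have b2 := one_lt_cfQuot_succ hβ (n + 1)
  rw [h0] at ea
  rw [h1] at ea'
  simp only [add_assoc, Nat.reduceAdd] at *
  generalize cfQuot α (n + 1) = x at *
  generalize cfQuot β (n + 1) = y at *
  generalize cfQuot α (n + 2) = x' at *
  generalize cfQuot β (n + 2) = y' at *
  have e : cfQuot α n - cfQuot β n = (x' - y') / ((x * x') * (y * y')) := by
    have e1 : cfQuot α n - cfQuot β n = x⁻¹ - y⁻¹ := by linarith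
    have e2 : x - y = x'⁻¹ - y'⁻¹ := by linarith
    have e3 : x⁻¹ - y⁻¹ = -(x - y) / (x * y) := by field_simp; ring
    rw [e1, e3, e2]
    field_simp
    ring
  have hp : 4 ≤ (x * x') * (y * y') := by nlinarith
  rw [e, abs_div, abs_of_pos (by linarith : 0 < (x * x') * (y * y'))]
  gcongr

theorem abs_sub_lt_of_floor_cfQuot_eq {α β : ℝ} (hα : Irrational α) (hβ : Irrational β) (m : ℕ)
    (h : ∀ i ≤ 2 * m, ⌊cfQuot α i⌋ = ⌊cfQuot β i⌋) : |α - β| < (1 / 4) ^ m := by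
  have hle : ∀ j ≤ m, |α - β| ≤ (1 / 4) ^ j * |cfQuot α (2 * j) - cfQuot β (2 * j)| := by
    intro j
    induction j with
    | zero => intro _; simp [cfQuot]
    | succ j ih =>
      intro hj
      refine (ih (by omega)).trans ?_
      rw [pow_succ, mul_assoc]
      gcongr
      have := abs_sub_cfQuot_le hα hβ (h (2 * j) (by omega)) (h (2 * j + 1) (by omega))
      rw [show 2 * (j + 1) = 2 * j + 2 by ring]
      linarith
  refine (hle m le_rfl).trans_lt ?_
  have := Int.abs_sub_lt_one_of_floor_eq_floor (h _ le_rfl)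
  exact mul_lt_of_lt_one_right (by positivity) this

theorem exists_coprime_mul_add {q r k : ℕ} (hq : 0 < q) (hk : 0 < k) (h : Nat.Coprime r q) :
    ∃ b, 1 ≤ b ∧ Nat.Coprime (b * q + r) k := by
  obtain ⟨p, hlt, hp, hmod⟩ := Nat.forall_exists_prime_gt_and_modEq (k + q + r) hq.ne' h
  obtain ⟨b, hb⟩ := (Nat.modEq_iff_dvd' (by omega)).1 hmod.symm
  refine ⟨b, Nat.one_le_iff_ne_zero.2 ?_, ?_⟩
  · rintro rfl
    omega
  · rw [mul_comm, ← hb, Nat.sub_add_cancel (by omega), hp.coprime_iff_not_dvd]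
    exact fun hd => absurd (Nat.le_of_dvd hk hd) (by omega)

/-- Near every irrational number there are irrational numbers having an arbitrarily late convergent
with denominator prime to `k` and followed by a large partial quotient. -/
theorem exists_irrational_near_rpow_le_cfa (ν : ℝ) {k : ℕ} (hk : 0 < k) {α : ℝ}
    (hα : Irrational α) {ε : ℝ} (hε : 0 < ε) (N : ℕ) :
    ∃ β, Irrational β ∧ |α - β| < ε ∧ ∃ n ≥ N,
      (cfq β n : ℝ) ^ ν ≤ (cfa β (n + 1) : ℝ) ∧ Nat.gcd (cfq β n) k = 1 := by
  obtain ⟨m₀, hm₀⟩ := exists_pow_lt_of_lt_one hε (by norm_num : (1 / 4 : ℝ) < 1)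
  set m := m₀ + N with hm
  obtain ⟨b, hb1, hb⟩ := exists_coprime_mul_add (cfq_pos hα (2 * m + 1)) hk
    (coprime_cfq_succ α (2 * m))
  set c : ℕ := ⌈((b * cfq α (2 * m + 1) + cfq α (2 * m) : ℕ) : ℝ) ^ ν⌉₊ + 1 with hc
  have hs : Irrational ((c : ℝ) + (√2)⁻¹) :=
    irrational_natCast_add_iff.2 (irrational_inv_iff.2 irrational_sqrt_two)
  have hs2 : (1 : ℝ) < √2 := Real.lt_sqrt_of_sq_lt (by norm_num)
  have hs0 : 0 < (√2)⁻¹ := by positivity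
  have hs1 : (√2)⁻¹ < 1 := inv_lt_one_of_one_lt₀ hs2
  have hc1 : (1 : ℝ) ≤ c := by exact_mod_cast Nat.le_add_left 1 _
  have hs3 : 1 < (c : ℝ) + (√2)⁻¹ := by linarith
  have hb1' : (1 : ℝ) ≤ b := by exact_mod_cast hb1
  have hy0 : 0 < ((c : ℝ) + (√2)⁻¹)⁻¹ := by positivity
  have hfl : ⌊(b : ℝ) + ((c : ℝ) + (√2)⁻¹)⁻¹⌋ = b := by
    rw [Int.floor_natCast_add, Int.floor_eq_zero_iff.2 ⟨hy0.le, inv_lt_one_of_one_lt₀ hs3⟩,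
      add_zero]
  obtain ⟨β, hβ, hpre, hq⟩ := exists_cfQuot_succ_eq hα (2 * m + 1)
    (irrational_natCast_add_iff.2 (irrational_inv_iff.2 hs) :
      Irrational ((b : ℝ) + ((c : ℝ) + (√2)⁻¹)⁻¹)) (by linarith)
  have hab : cfa β (2 * m + 2) = b := by
    rw [cfa, hq, hfl, Int.toNat_natCast]
  have hac : cfa β (2 * m + 3) = c := by
    rw [cfa, cfQuot, hq, hfl, Int.cast_natCast, add_sub_cancel_left, inv_inv,
      Int.floor_natCast_add, Int.floor_eq_zero_iff.2 ⟨hs0.le, hs1⟩, add_zero, Int.toNat_natCast]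
  have hcfa : ∀ i ≤ 2 * m + 1, cfa β i = cfa α i := fun i hi => by rw [cfa, cfa, hpre i hi]
  have hcfq : cfq β (2 * m + 2) = b * cfq α (2 * m + 1) + cfq α (2 * m) := by
    rw [cfq, hab, cfq_congr _ hcfa, cfq_congr _ fun i hi => hcfa i (by omega)]
  refine ⟨β, hβ, ?_, 2 * m + 2, by omega, ?_, ?_⟩
  · refine (abs_sub_lt_of_floor_cfQuot_eq hα hβ m fun i hi => (hpre i (by omega)).symm).trans_le
      (le_trans ?_ hm₀.le)
    exact pow_le_pow_of_le_one (by norm_num) (by norm_num) (by omega)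
  · rw [hac, hcfq, hc]
    push_cast
    exact (Nat.le_ceil _).trans (le_add_of_nonneg_right zero_le_one)
  · rw [hcfq]
    exact hb

/-- For every `ν > 0` and every integer `k ≥ 2`, the set
`W(ν,k)` of irrational numbers `α` such that, for infinitely many `n`,
`a_{n+1} ≥ qₙ^ν` and `gcd(qₙ, k) = 1`, is a dense `Gδ` subset of `ℝ`. -/
theorem stmt_13 (ν : ℝ) (hν : 0 < ν) (k : ℕ) (hk : 2 ≤ k) :
    IsGδ {α : ℝ | Irrational α ∧ ∀ N : ℕ, ∃ n ≥ N,
        (cfq α n : ℝ) ^ ν ≤ (cfa α (n + 1) : ℝ) ∧ Nat.gcd (cfq α n) k = 1} ∧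
      Dense {α : ℝ | Irrational α ∧ ∀ N : ℕ, ∃ n ≥ N,
        (cfq α n : ℝ) ^ ν ≤ (cfa α (n + 1) : ℝ) ∧ Nat.gcd (cfq α n) k = 1} := by
  set S : ℕ → Set ℝ := fun n =>
    {α | (cfq α n : ℝ) ^ ν ≤ (cfa α (n + 1) : ℝ) ∧ Nat.gcd (cfq α n) k = 1} with hS
  have mem_interior {α : ℝ} (hα : Irrational α) {n : ℕ} (h : α ∈ S n) : α ∈ interior (S n) := by
    rw [mem_interior_iff_mem_nhds]
    filter_upwards [eventually_cfa_eq hα (n + 1)] with β hβ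
    have hq : cfq β n = cfq α n := cfq_congr n fun i hi => hβ i (by omega)
    simp only [hS, Set.mem_ofPred_eq, hq, hβ (n + 1) le_rfl]
    exact h
  set U : ℕ → Set ℝ := fun N => ⋃ n ≥ N, interior (S n) with hU
  have hW : {α : ℝ | Irrational α ∧ ∀ N : ℕ, ∃ n ≥ N,
      (cfq α n : ℝ) ^ ν ≤ (cfa α (n + 1) : ℝ) ∧ Nat.gcd (cfq α n) k = 1} =
      {α | Irrational α} ∩ ⋂ N, U N := by
    ext α
    simp only [hU, Set.mem_inter_iff, Set.mem_ofPred_eq, Set.mem_iInter, Set.mem_iUnion, exists_prop]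
    exact and_congr_right fun hα => forall_congr' fun N => exists_congr fun n =>
      and_congr_right fun _ => ⟨fun h => mem_interior hα h, fun h => interior_subset (s := S n) h⟩
  have hUo (N : ℕ) : IsOpen (U N) := isOpen_biUnion fun _ _ => isOpen_interior
  have hUd (N : ℕ) : Dense (U N) := by
    refine dense_closure.1 (dense_irrational.mono fun α hα => Metric.mem_closure_iff.2 ?_)
    intro ε hε
    obtain ⟨β, hβ, hd, n, hn, h⟩ :=
      exists_irrational_near_rpow_le_cfa ν (by omega : 0 < k) hα hε N
    exact ⟨β, Set.mem_biUnion hn (mem_interior hβ h), hd⟩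
  rw [hW]
  exact ⟨IsGδ.setOfPred_irrational.inter (.iInter_of_isOpen hUo),
    dense_irrational.inter_of_Gδ IsGδ.setOfPred_irrational (.iInter_of_isOpen hUo)
      (dense_iInter_of_isOpen hUo hUd)⟩
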